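/- arXiv:2209.03265 — 3 statements merged into one kernel-verified Lean document; each statement's English description precedes it below -/
import Mathlib

section
/- Let k ≥ 0 be an integer and let qt(n) = 3c·n² + bc·n, where b and c are non-zero integers satisfying all of the following: (1) b ≥ −2; (2) 3 does not divide bc; (3) if b is even, then c is even; (4) if b is odd and there exists an integer x such that 2·3^k < 2^x < 3^{k+1}, 2^x ≤ |b|, and (b mod 2^x) ≡ 0 (mod 3), then c is even; (5) for every prime number p such that 2·3^k < p < 3^{k+1}, p ≤ |b|, and (b mod p) ≡ 0 (mod 3), p divides c. Then for every positive integer m < 3^{k+1}, there exist integers i and j with 0 ≤ i < j ≤ 3^k such that m divides qt(j) − qt(i). -/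
/-- The target property: a collision modulo `m` among indices up to `N`. -/
def Coll (N : ℕ) (b c : ℤ) (m : ℕ) : Prop :=
  ∃ r t : ℕ, 0 < t ∧ r + t ≤ N ∧ (m : ℤ) ∣ c * t * (6 * r + 3 * t + b)

lemma solve (q : ℕ) (hq : 0 < q) (u B : ℤ) (h : IsCoprime u (q : ℤ)) :
    ∃ r : ℕ, r < q ∧ (q : ℤ) ∣ u * r + B := by
  obtain ⟨x, y, hxy⟩ := h
  have hq' : (0 : ℤ) < q := by exact_mod_cast hq
  refine ⟨((-B * x) % q).toNat, ?_, ?_⟩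
  · have h1 := Int.emod_nonneg (-B * x) hq'.ne'
    have h2 := Int.emod_lt_of_pos (-B * x) hq'
    omega
  · have h1 := Int.emod_nonneg (-B * x) hq'.ne'
    rw [Int.toNat_of_nonneg h1, Int.emod_def]
    refine ⟨B * y - u * ((-B * x) / q), ?_⟩
    linear_combination (-B) * hxy

lemma cop3 (q : ℕ) (h : ¬ 3 ∣ q) : IsCoprime (3 : ℤ) (q : ℤ) := by
  have : Nat.Coprime 3 q := (Nat.Prime.coprime_iff_not_dvd Nat.prime_three).2 h
  exact_mod_cast Nat.isCoprime_iff_coprime.2 this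

lemma cop6 (q : ℕ) (h : ¬ 3 ∣ q) (h2 : ¬ 2 ∣ q) : IsCoprime (6 : ℤ) (q : ℤ) := by
  have h3 : Nat.Coprime 3 q := (Nat.Prime.coprime_iff_not_dvd Nat.prime_three).2 h
  have h4 : Nat.Coprime 2 q := (Nat.Prime.coprime_iff_not_dvd Nat.prime_two).2 h2
  have : Nat.Coprime (2 * 3) q := Nat.Coprime.mul_left h4 h3
  exact_mod_cast Nat.isCoprime_iff_coprime.2 this

lemma collS {N : ℕ} {b c : ℤ} {m s : ℕ} (hs : 1 ≤ s) (hs2 : s + 1 ≤ 2 * N)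
    (h : (m : ℤ) ∣ c * (3 * s + b)) : Coll N b c m := by
  rcases Nat.even_or_odd' s with ⟨w, rfl | rfl⟩
  · refine ⟨w - 1, 2, by omega, by omega, ?_⟩
    obtain ⟨v, rfl⟩ : ∃ v, w = v + 1 := ⟨w - 1, by omega⟩
    refine (h.mul_left 2).trans (dvd_of_eq ?_)
    push_cast
    ring
  · refine ⟨w, 1, by omega, by omega, ?_⟩
    refine h.trans (dvd_of_eq ?_)
    push_cast
    ring

/-- As `collS`, gaining a factor 2 from parity when `b` is odd. -/
lemma collS2 {N : ℕ} {b c : ℤ} {q s : ℕ} (hb : Odd b) (hq : Odd q) (hs : 1 ≤ s)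
    (hs2 : s + 1 ≤ 2 * N) (h : (q : ℤ) ∣ 3 * s + b) : Coll N b c (2 * q) := by
  rcases Nat.even_or_odd' s with ⟨w, rfl | rfl⟩
  · refine ⟨w - 1, 2, by omega, by omega, ?_⟩
    obtain ⟨v, rfl⟩ : ∃ v, w = v + 1 := ⟨w - 1, by omega⟩
    obtain ⟨z, hz⟩ := h
    refine ⟨c * z, ?_⟩
    push_cast at hz ⊢
    linear_combination 2 * c * hz
  · refine ⟨w, 1, by omega, by omega, ?_⟩
    have h2 : (2 : ℤ) ∣ 3 * ((2 * w + 1 : ℕ) : ℤ) + b := by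
      obtain ⟨v, rfl⟩ := hb
      push_cast
      omega
    have hc : IsCoprime (2 : ℤ) (q : ℤ) := by
      have : Nat.Coprime 2 q := Nat.coprime_two_left.2 hq
      exact_mod_cast Nat.isCoprime_iff_coprime.2 this
    have := hc.mul_dvd h2 h
    have h4 := this.mul_left c
    push_cast at h4 ⊢
    refine h4.trans (dvd_of_eq ?_)
    ring

lemma solveS (q : ℕ) (hq : 0 < q) (h : ¬ 3 ∣ q) (b : ℤ) :
    ∃ s : ℕ, 1 ≤ s ∧ s ≤ q ∧ (q : ℤ) ∣ 3 * s + b := by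
  obtain ⟨r, hr, hd⟩ := solve q hq 3 (3 + b) (cop3 q h)
  refine ⟨r + 1, by omega, by omega, ?_⟩
  push_cast
  refine hd.trans (dvd_of_eq ?_)
  ring

/-- The residue analysis for `2N < m < 3N`, `3 ∤ m`. -/
lemma solveD (N m : ℕ) (b : ℤ) (hm2 : m < 3 * N) (h3 : ¬ 3 ∣ m)
    (hb : ¬ (3 : ℤ) ∣ b % (m : ℤ)) :
    ∃ s : ℕ, 1 ≤ s ∧ s + 1 ≤ 2 * N ∧ (m : ℤ) ∣ 3 * s + b := by
  have hm0 : (0 : ℤ) < m := by omega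
  have r1 := Int.emod_nonneg b hm0.ne'
  have r2 := Int.emod_lt_of_pos b hm0
  have e := Int.emod_add_mul_ediv b m
  set r := b % (m : ℤ)
  set Q := b / (m : ℤ)
  have : (3 : ℤ) ∣ m - r ∨ (3 : ℤ) ∣ 2 * m - r := by
    clear_value r Q
    clear e
    rcases (by omega : (m : ℤ) % 3 = 1 ∨ (m : ℤ) % 3 = 2) with h | h <;>
      rcases (by omega : r % 3 = 1 ∨ r % 3 = 2) with h' | h' <;> omega
  rcases this with ⟨z, hz⟩ | ⟨z, hz⟩
  · refine ⟨z.toNat, by omega, by omega, ?_⟩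
    rw [Int.toNat_of_nonneg (by omega)]
    exact ⟨1 + Q, by linear_combination -hz - e⟩
  · refine ⟨z.toNat, by omega, by omega, ?_⟩
    rw [Int.toNat_of_nonneg (by omega)]
    exact ⟨2 + Q, by linear_combination -hz - e⟩

/-- Small `|b|`. -/
lemma solveE (N m : ℕ) (b : ℤ) (hm2 : m < 3 * N) (h3 : ¬ 3 ∣ m) (h1 : -2 ≤ b)
    (hb3 : ¬ (3 : ℤ) ∣ b) (hbm : |b| < m) (hN : b = -2 → m + 1 < 3 * N) :
    ∃ s : ℕ, 1 ≤ s ∧ s + 1 ≤ 2 * N ∧ (m : ℤ) ∣ 3 * s + b := by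
  by_cases hr : (3 : ℤ) ∣ b % (m : ℤ)
  · rcases lt_or_ge b 0 with hneg | hpos
    · have e : b % (m : ℤ) = b + m := by
        rw [← Int.add_emod_right]
        apply Int.emod_eq_of_lt <;> [rw [abs_lt] at hbm; skip] <;> omega
      rw [e] at hr
      obtain ⟨z, hz⟩ : (3 : ℤ) ∣ 2 * m - b := by omega
      rw [abs_lt] at hbm
      refine ⟨z.toNat, by omega, ?_, ?_⟩
      · rcases (by omega : b = -1 ∨ b = -2) with rfl | rfl
        · omega
        · have := hN rfl
          omega
      · rw [Int.toNat_of_nonneg (by omega)]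
        exact ⟨2, by linear_combination -hz⟩
    · rw [abs_of_nonneg hpos] at hbm
      rw [Int.emod_eq_of_lt hpos hbm] at hr
      exact absurd hr hb3
  · exact solveD N m b hm2 h3 hr

/-- Moduli prime to 3 with `2N ≤ m`. -/
lemma caseA (N m : ℕ) (b c : ℤ) (hN : Odd N) (hN9 : N = 1 ∨ N = 3 ∨ 9 ≤ N)
    (hm1 : 2 * N ≤ m) (hm2 : m < 3 * N)
    (h3m : ¬ 3 ∣ m) (h1 : -2 ≤ b) (hb3 : ¬ (3 : ℤ) ∣ b) (h3 : Even b → Even c)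
    (h4 : Odd b → ∀ x : ℕ, m = 2 ^ x → 2 * N < m → (m : ℤ) ≤ |b| → (3 : ℤ) ∣ b % (m : ℤ) →
      Even c)
    (h5 : m.Prime → 2 * N < m → (m : ℤ) ≤ |b| → (3 : ℤ) ∣ b % (m : ℤ) → (m : ℤ) ∣ c) :
    Coll N b c m := by
  obtain ⟨n0, hn0⟩ := hN
  rcases Nat.even_or_odd' m with ⟨q, hq | hq⟩
  · -- even modulus
    have hevenc : Even c → Coll N b c m := by
      rintro ⟨c', rfl⟩
      obtain ⟨s, s1, s2, z, hz⟩ := solveS q (by omega) (by omega) b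
      refine collS s1 (by omega) ⟨c' * z, ?_⟩
      subst hq
      push_cast
      linear_combination 2 * c' * hz
    rcases Int.even_or_odd b with hbe | hbo
    · exact hevenc (h3 hbe)
    rcases Nat.even_or_odd' q with ⟨q2, hq2 | hq2⟩
    · obtain ⟨a, o, ho, hao⟩ := Nat.exists_eq_two_pow_mul_odd (n := q) (by omega)
      have ha : a ≠ 0 := by
        rintro rfl
        obtain ⟨w, rfl⟩ := ho
        omega
      by_cases ho1 : o = 1
      · have hmx : m = 2 ^ (a + 1) := by rw [hq, hao, ho1]; ring
        by_cases hc : (m : ℤ) ≤ |b| ∧ (3 : ℤ) ∣ b % (m : ℤ)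
        · by_cases hlt : 2 * N < m
          · exact hevenc (h4 hbo _ hmx hlt hc.1 hc.2)
          · omega
        · have : ∃ s : ℕ, 1 ≤ s ∧ s + 1 ≤ 2 * N ∧ (m : ℤ) ∣ 3 * s + b := by
            by_cases hbm : (m : ℤ) ≤ |b|
            · exact solveD N m b hm2 h3m (fun h => hc ⟨hbm, h⟩)
            · refine solveE N m b hm2 h3m h1 hb3 (by omega) ?_
              rintro rfl
              exact absurd hbo (by decide)
          obtain ⟨s, s1, s2, hs⟩ := this
          exact collS s1 s2 (hs.mul_left c)
      · have ho3 : ¬ 3 ∣ o := fun h => h3m (by rw [hq, hao]; exact (h.mul_left _).mul_left _)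
        have ho5 : 5 ≤ o := by
          obtain ⟨w, rfl⟩ := ho
          omega
        have h2a : 2 ≤ 2 ^ a := by
          calc 2 = 2 ^ 1 := rfl
            _ ≤ 2 ^ a := Nat.pow_le_pow_right (by norm_num) (by omega)
        have hh3 : ¬ 3 ∣ 2 ^ a := fun h => h3m (by rw [hq, hao]; exact (h.mul_right _).mul_left _)
        set h := 2 ^ a
        have hsum : o + h ≤ N + 1 := by
          have : 10 ≤ h * o := by nlinarith
          have h9 : 9 ≤ N := by omega
          have : (h - 2 : ℤ) * (o - 2) ≥ 0 := mul_nonneg (by omega) (by omega)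
          have e : (h : ℤ) * o = q := by exact_mod_cast hao.symm
          have : (h : ℤ) * o = 2 * (h + o) - 4 + (h - 2 : ℤ) * (o - 2) := by ring
          omega
        have hbo' := hbo
        obtain ⟨B, hB⟩ : (2 : ℤ) ∣ 3 * o + b := by
          obtain ⟨w, rfl⟩ := ho
          obtain ⟨v, rfl⟩ := hbo'
          push_cast
          omega
        obtain ⟨r, hr, z, hz⟩ := solve h (by omega) 3 B (cop3 h hh3)
        refine ⟨r, o, by omega, by omega, c * z, ?_⟩
        rw [hq, hao]
        push_cast
        linear_combination c * o * hB + 2 * c * o * hz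
    · obtain ⟨s, s1, s2, hs⟩ := solveS q (by omega) (by omega) b
      rw [hq]
      exact collS2 hbo ⟨q2, hq2⟩ s1 (by omega) hs
  · -- odd modulus
    by_cases hp : m.Prime
    · by_cases hc : (m : ℤ) ≤ |b| ∧ (3 : ℤ) ∣ b % (m : ℤ)
      · refine ⟨0, 1, by omega, by omega, ?_⟩
        exact ((h5 hp (by omega) hc.1 hc.2).mul_right _).mul_right _
      · have : ∃ s : ℕ, 1 ≤ s ∧ s + 1 ≤ 2 * N ∧ (m : ℤ) ∣ 3 * s + b := by
          by_cases hbm : (m : ℤ) ≤ |b|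
          · exact solveD N m b hm2 h3m (fun h => hc ⟨hbm, h⟩)
          · exact solveE N m b hm2 h3m h1 hb3 (by omega) (by omega)
        obtain ⟨s, s1, s2, hs⟩ := this
        exact collS s1 s2 (hs.mul_left c)
    · obtain ⟨d, ⟨e, he⟩, hd1, hd2⟩ := Nat.exists_dvd_of_not_prime2 (n := m) (by omega) hp
      have d2 : ¬ 2 ∣ d := fun h => by
        have : 2 ∣ m := he ▸ h.mul_right e
        omega
      have d3 : ¬ 3 ∣ d := fun h => h3m (he ▸ h.mul_right e)
      have e2 : ¬ 2 ∣ e := fun h => by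
        have : 2 ∣ m := he ▸ h.mul_left d
        omega
      have e3 : ¬ 3 ∣ e := fun h => h3m (he ▸ h.mul_left d)
      have e1 : e ≠ 1 := by
        rintro rfl
        omega
      have d5 : 5 ≤ d := by omega
      have e5 : 5 ≤ e := by omega
      have hsum : d + e ≤ N + 1 := by
        have : 25 ≤ d * e := by nlinarith
        have h9 : 9 ≤ N := by omega
        have : (d - 5 : ℤ) * (e - 5) ≥ 0 := mul_nonneg (by omega) (by omega)
        have hde : (d : ℤ) * e = m := by exact_mod_cast he.symm
        have : (d : ℤ) * e = 5 * (d + e) - 25 + (d - 5 : ℤ) * (e - 5) := by ring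
        omega
      obtain ⟨r, hr, z, hz⟩ := solve e (by omega) 6 (3 * d + b) (cop6 e e3 e2)
      refine ⟨r, d, by omega, by omega, c * z, ?_⟩
      rw [he]
      push_cast
      linear_combination c * d * hz

/-- Moduli divisible by 3: `m = T q`, `N = T M` with `T = 3^a`. -/
lemma caseB (T M q : ℕ) (b c : ℤ) (hT : 3 ≤ T) (hTo : Odd T) (hMo : Odd M)
    (hM : M = 1 ∨ 3 ≤ M) (hq0 : 0 < q) (hq : q < 3 * M) (hq3 : ¬ 3 ∣ q) (h3 : Even b → Even c) :
    Coll (T * M) b c (T * q) := by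
  have hTM : T * M = T + T * (M - 1) := by
    obtain ⟨w, rfl⟩ : ∃ w, M = w + 1 := ⟨M - 1, by omega⟩
    simp; ring
  have hTM3 : 3 * (M - 1) ≤ T * (M - 1) := Nat.mul_le_mul_right _ hT
  rcases Nat.even_or_odd' q with ⟨u, hu | hu⟩
  · rcases Int.even_or_odd b with hbe | hbo
    · obtain ⟨c', rfl⟩ := h3 hbe
      obtain ⟨b', rfl⟩ := hbe
      rcases hM with rfl | hM
      · refine ⟨0, T, by omega, by omega, c' * (3 * T + b' + b'), ?_⟩
        have : q = 2 := by omega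
        subst this
        push_cast
        ring
      · have hTM' : T * M = 2 * T + T * (M - 2) := by
          obtain ⟨w, rfl⟩ : ∃ w, M = w + 2 := ⟨M - 2, by omega⟩
          simp; ring
        have hTM3' : 3 * (M - 2) ≤ T * (M - 2) := Nat.mul_le_mul_right _ hT
        obtain ⟨r, hr, z, hz⟩ := solve u (by omega) 3 (3 * T + b') (cop3 u (by omega))
        obtain ⟨v, hv⟩ := hMo
        refine ⟨r, 2 * T, by omega, by omega, 4 * c' * z, ?_⟩
        rw [hu]
        push_cast
        linear_combination 8 * c' * T * hz
    · obtain ⟨B, hB⟩ : (2 : ℤ) ∣ 3 * T + b := by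
        obtain ⟨w, rfl⟩ := hTo
        obtain ⟨v, rfl⟩ := hbo
        push_cast
        omega
      obtain ⟨r, hr, z, hz⟩ := solve u (by omega) 3 B (cop3 u (by omega))
      refine ⟨r, T, by omega, by omega, c * z, ?_⟩
      rw [hu]
      push_cast
      linear_combination c * T * hB + 2 * c * T * hz
  · obtain ⟨r, hr, z, hz⟩ := solve q (by omega) 6 (3 * T + b) (cop6 q hq3 (by omega))
    obtain ⟨v, hv⟩ := hMo
    refine ⟨r, T, by omega, by omega, c * z, ?_⟩
    push_cast
    linear_combination c * T * hz

lemma pow3_cases (k : ℕ) : 3 ^ k = 1 ∨ 3 ^ k = 3 ∨ 9 ≤ 3 ^ k := by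
  rcases k with _ | _ | k
  · simp
  · simp
  · right; right
    have : 0 < 3 ^ k := by positivity
    rw [pow_succ, pow_succ]
    omega

lemma mainColl (k : ℕ) (b c : ℤ)
    (h1 : -2 ≤ b)
    (h2 : ¬ ((3 : ℤ) ∣ b * c))
    (h3 : Even b → Even c)
    (h4 : (Odd b ∧ ∃ x : ℕ, 2 * 3 ^ k < 2 ^ x ∧ 2 ^ x < 3 ^ (k + 1) ∧
        (2 : ℤ) ^ x ≤ |b| ∧ (3 : ℤ) ∣ b % (2 : ℤ) ^ x) → Even c)
    (h5 : ∀ p : ℕ, p.Prime → 2 * 3 ^ k < p → p < 3 ^ (k + 1) →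
        (p : ℤ) ≤ |b| → (3 : ℤ) ∣ b % (p : ℤ) → (p : ℤ) ∣ c)
    (m : ℕ) (hm0 : 0 < m) (hm : m < 3 ^ (k + 1)) : Coll (3 ^ k) b c m := by
  have hpow : 3 ^ (k + 1) = 3 * 3 ^ k := by ring
  have hodd : ∀ n : ℕ, Odd (3 ^ n) := fun n => Odd.pow (by decide)
  by_cases h3m : 3 ∣ m
  · obtain ⟨a, q, hq3, hmq⟩ := Nat.exists_eq_pow_mul_and_not_dvd hm0.ne' 3 (by norm_num)
    have hq0 : 0 < q := by
      rcases Nat.eq_zero_or_pos q with rfl | h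
      · simp at hq3
      · exact h
    have ha : a ≠ 0 := by
      rintro rfl
      apply hq3
      simpa [hmq] using h3m
    have hak : a ≤ k := by
      have : 3 ^ a < 3 ^ (k + 1) := lt_of_le_of_lt (hmq ▸ Nat.le_mul_of_pos_right _ hq0) hm
      have := (Nat.pow_lt_pow_iff_right (by norm_num)).1 this
      omega
    obtain ⟨l, rfl⟩ := Nat.exists_eq_add_of_le hak
    have hT : 3 ≤ 3 ^ a := by
      calc 3 = 3 ^ 1 := rfl
        _ ≤ 3 ^ a := Nat.pow_le_pow_right (by norm_num) (by omega)
    rw [hmq, pow_add]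
    refine caseB (3 ^ a) (3 ^ l) q b c hT (hodd a) (hodd l) ?_ hq0 ?_ hq3 h3
    · have := pow3_cases l
      omega
    · have : 3 ^ a * q < 3 ^ a * (3 * 3 ^ l) := by
        rw [← hmq]
        refine hm.trans_eq ?_
        ring
      exact lt_of_mul_lt_mul_left this (by positivity)
  · by_cases hm1 : m < 2 * 3 ^ k
    · obtain ⟨s, s1, s2, hs⟩ := solveS m hm0 h3m b
      exact collS s1 (by omega) (hs.mul_left c)
    · refine caseA (3 ^ k) m b c (hodd k) (pow3_cases k) (by omega) (by omega) h3m h1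
        (fun h => h2 (h.mul_right c)) h3 ?_ ?_
      · rintro hbo x rfl hx1 hx2 hx3
        push_cast at hx2 hx3
        exact h4 ⟨hbo, x, hx1, hm, hx2, hx3⟩
      · intro hp hl
        exact h5 m hp hl hm


/-- For `qt(n) = 3c n² + bc n` with non-zero integers `b, c`
satisfying conditions (1)–(5) (here `b % m` is the residue of `b` in
`{0, …, m−1}`, which is `Int.emod` for positive `m`), for every positive
`m < 3^(k+1)` there are `0 ≤ i < j ≤ 3^k` with `m ∣ qt(j) − qt(i)`. -/
theorem stmt_17 (k : ℕ) (b c : ℤ) (hb0 : b ≠ 0) (hc0 : c ≠ 0)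
    (h1 : -2 ≤ b)
    (h2 : ¬ ((3 : ℤ) ∣ b * c))
    (h3 : Even b → Even c)
    (h4 : (Odd b ∧ ∃ x : ℕ, 2 * 3 ^ k < 2 ^ x ∧ 2 ^ x < 3 ^ (k + 1) ∧
        (2 : ℤ) ^ x ≤ |b| ∧ (3 : ℤ) ∣ b % (2 : ℤ) ^ x) → Even c)
    (h5 : ∀ p : ℕ, p.Prime → 2 * 3 ^ k < p → p < 3 ^ (k + 1) →
        (p : ℤ) ≤ |b| → (3 : ℤ) ∣ b % (p : ℤ) → (p : ℤ) ∣ c)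
    (qt : ℕ → ℤ) (hqt : ∀ n : ℕ, qt n = 3 * c * (n : ℤ) ^ 2 + b * c * (n : ℤ)) :
    ∀ m : ℕ, 0 < m → m < 3 ^ (k + 1) →
      ∃ i j : ℕ, i < j ∧ j ≤ 3 ^ k ∧ (m : ℤ) ∣ qt j - qt i := by

  intro m hm0 hm
  obtain ⟨r, t, ht, hrt, hd⟩ := mainColl k b c h1 h2 h3 h4 h5 m hm0 hm
  refine ⟨r, r + t, by omega, hrt, hd.trans (dvd_of_eq ?_)⟩
  rw [hqt, hqt]
  push_cast
  ring
end

section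
/- Let b and c be non-zero integers with 3 not dividing bc, and let qt(n) = 3c·n² + bc·n. Then for every integer k ≥ 0 and all integers i, j with 0 ≤ i < j < 3^{k+1}, 3^{k+1} does not divide qt(j) − qt(i). -/
/-- For `qt(n) = 3c n² + bc n` with non-zero integers `b, c` and
`3 ∤ bc`, for every `k ≥ 0` and all `0 ≤ i < j < 3^(k+1)`, `3^(k+1)` does not
divide `qt(j) − qt(i)`. -/
theorem stmt_18 (b c : ℤ) (hb0 : b ≠ 0) (hc0 : c ≠ 0) (h3 : ¬ ((3 : ℤ) ∣ b * c))
    (qt : ℕ → ℤ) (hqt : ∀ n : ℕ, qt n = 3 * c * (n : ℤ) ^ 2 + b * c * (n : ℤ)) :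
    ∀ k i j : ℕ, i < j → j < 3 ^ (k + 1) →
      ¬ ((3 : ℤ) ^ (k + 1) ∣ qt j - qt i) := by
  intro k i j hij hj hd
  have hp : Prime (3 : ℤ) := Int.prime_three
  have hfac : qt j - qt i = (3 * (c * ((i : ℤ) + j)) + b * c) * ((j : ℤ) - i) := by
    rw [hqt, hqt]; ring
  rw [hfac] at hd
  have hn : ¬ (3 : ℤ) ∣ 3 * (c * ((i : ℤ) + j)) + b * c := fun h =>
    h3 ((dvd_add_right (dvd_mul_right _ _)).1 h)
  have hcop : IsCoprime ((3 : ℤ) ^ (k + 1)) (3 * (c * ((i : ℤ) + j)) + b * c) :=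
    ((Prime.coprime_iff_not_dvd hp).2 hn).pow_left
  have hd2 := hcop.dvd_of_dvd_mul_left hd
  have hle := Int.le_of_dvd (by omega) hd2
  have hj' : (j : ℤ) < 3 ^ (k + 1) := by exact_mod_cast hj
  have hi : (0 : ℤ) ≤ i := Int.natCast_nonneg i
  linarith
end

section
/- Let qt(n) = 3c·n² + bc·n, where b and c are non-zero integers satisfying all of the following: (1) b ≥ −2; (2) 3 does not divide bc; (3) if b is even, then c is even; (4) if b is odd and there exist positive integers x and k such that 2·3^k < 2^x < 3^{k+1}, 2^x ≤ |b|, and (b mod 2^x) ≡ 0 (mod 3), then c is even; (5) for every prime number p such that 2·3^k < p < 3^{k+1} for some positive integer k, p ≤ |b|, and (b mod p) ≡ 0 (mod 3), p divides c. Then the discriminator satisfies D_{qt}(n) = 3^{⌈log_3 n⌉} for all n ≥ 1. -/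
theorem aux_inv (N : ℕ) (hN : 0 < N) (g z : ℤ) (hg : IsCoprime g (N : ℤ)) :
    ∃ i : ℕ, i < N ∧ (N : ℤ) ∣ g * i + z := by
  obtain ⟨u, v, huv⟩ := hg
  have hNz : (0 : ℤ) < N := by exact_mod_cast hN
  have h0 := Int.emod_nonneg (-(u * z)) hNz.ne'
  have h1 := Int.emod_lt_of_pos (-(u * z)) hNz
  have h2 := Int.emod_add_mul_ediv (-(u * z)) N
  refine ⟨((-(u * z)) % N).toNat, by omega, ?_⟩
  rw [Int.toNat_of_nonneg h0]
  refine ⟨v * z - g * ((-(u * z)) / N), ?_⟩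
  linear_combination g * h2 - z * huv

theorem aux_cop3 (N : ℕ) (h : ¬ 3 ∣ N) : IsCoprime (3 : ℤ) (N : ℤ) := by
  have : Nat.Coprime 3 N := (Nat.Prime.coprime_iff_not_dvd Nat.prime_three).2 h
  exact_mod_cast Nat.isCoprime_iff_coprime.2 this

theorem aux_cop6 (N : ℕ) (h : ¬ 3 ∣ N) (h2 : ¬ 2 ∣ N) : IsCoprime (6 : ℤ) (N : ℤ) := by
  have h3 := aux_cop3 N h
  have : Nat.Coprime 2 N := (Nat.Prime.coprime_iff_not_dvd Nat.prime_two).2 h2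
  have h4 : IsCoprime (2 : ℤ) (N : ℤ) := by exact_mod_cast Nat.isCoprime_iff_coprime.2 this
  have := IsCoprime.mul_left h4 h3
  norm_num at this
  exact this

theorem aux_split (T s : ℕ) (h1 : 1 ≤ s) (h2 : s < 2 * T) :
    ∃ i j : ℕ, i < j ∧ j ≤ T ∧ i + j = s := by
  by_cases h : s ≤ T
  · exact ⟨0, s, by omega, h, by omega⟩
  · exact ⟨s - T, T, by omega, le_rfl, by omega⟩

theorem aux_core (b : ℤ) (T N : ℕ) (h3 : ¬ 3 ∣ N) (h0 : 0 < N) (hN : N < 2 * T) :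
    ∃ i j : ℕ, i < j ∧ j ≤ T ∧ (N : ℤ) ∣ 3 * ((i : ℤ) + j) + b := by
  obtain ⟨i, hi, hd⟩ := aux_inv N h0 3 (b + 3) (aux_cop3 N h3)
  obtain ⟨p, q, h, h', hs⟩ := aux_split T (i + 1) (by omega) (by omega)
  refine ⟨p, q, h, h', ?_⟩
  have : (p : ℤ) + q = i + 1 := by exact_mod_cast hs
  rw [this]
  convert hd using 1
  ring

theorem aux_q (b : ℤ) (T q : ℕ) (hq3 : ¬ 3 ∣ q) (hqT : q < 3 * T)
    (hq2 : 2 < q) (hbq : q + 2 ≤ 3 * T ∨ b ≠ -2) (hb3 : ¬ (3 : ℤ) ∣ b) (hb : -2 ≤ b)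
    (h : (q : ℤ) ≤ |b| → ¬ (3 : ℤ) ∣ b % (q : ℤ)) :
    ∃ i j : ℕ, i < j ∧ j ≤ T ∧ (q : ℤ) ∣ 3 * ((i : ℤ) + j) + b := by
  suffices hs : ∃ s : ℕ, 1 ≤ s ∧ s < 2 * T ∧ (q : ℤ) ∣ 3 * (s : ℤ) + b by
    obtain ⟨s, h1, h2, h3⟩ := hs
    obtain ⟨i, j, hij, hj, hs⟩ := aux_split T s h1 h2
    refine ⟨i, j, hij, hj, ?_⟩
    have : (i : ℤ) + j = s := by exact_mod_cast hs
    rwa [this]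
  by_cases hneg : b < 0
  · by_cases ht : (3 : ℤ) ∣ q - b
    · obtain ⟨w, hw⟩ := ht
      refine ⟨w.toNat, by omega, by omega, 1, ?_⟩
      rw [Int.toNat_of_nonneg (by omega)]; linarith
    · have ht : (3 : ℤ) ∣ 2 * q - b := by
        have hq : q % 3 = 1 ∨ q % 3 = 2 := by omega
        have hv : b % 3 = 1 ∨ b % 3 = 2 := by omega
        rcases hq with hq | hq <;> rcases hv with hv | hv <;> omega
      obtain ⟨w, hw⟩ := ht
      refine ⟨w.toNat, by omega, by omega, 2, ?_⟩
      rw [Int.toNat_of_nonneg (by omega)]; linarith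
  · have hr : ¬ (3 : ℤ) ∣ b % (q : ℤ) := by
      by_cases hle : (q : ℤ) ≤ |b|
      · exact h hle
      · rw [abs_of_nonneg (by omega)] at hle
        rwa [Int.emod_eq_of_lt (by omega) (by omega)]
    have hqz : (0 : ℤ) < q := by omega
    have h0 := Int.emod_nonneg b hqz.ne'
    have h1 := Int.emod_lt_of_pos b hqz
    have h2 := Int.emod_add_mul_ediv b q
    generalize b % (q : ℤ) = r at *
    by_cases ht : (3 : ℤ) ∣ q - r
    · obtain ⟨w, hw⟩ := ht
      refine ⟨w.toNat, by omega, by omega, 1 + b / q, ?_⟩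
      rw [Int.toNat_of_nonneg (by omega)]; linarith
    · have ht : (3 : ℤ) ∣ 2 * q - r := by
        have hq : q % 3 = 1 ∨ q % 3 = 2 := by omega
        have hv : r % 3 = 1 ∨ r % 3 = 2 := by omega
        rcases hq with hq | hq <;> rcases hv with hv | hv <;> omega
      obtain ⟨w, hw⟩ := ht
      refine ⟨w.toNat, by omega, by omega, 2 + b / q, ?_⟩
      rw [Int.toNat_of_nonneg (by omega)]; linarith

theorem aux_caseA (b c : ℤ) (h1 : -2 ≤ b) (hb3 : ¬ (3 : ℤ) ∣ b)
    (h3 : Even b → Even c) (T m : ℕ) (hT : 3 ≤ T) (hTo : ¬ 2 ∣ T)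
    (h4 : (Odd b ∧ ∃ x : ℕ, 0 < x ∧ m = 2 ^ x ∧ (m : ℤ) ≤ |b| ∧ (3 : ℤ) ∣ b % (m : ℤ)) → Even c)
    (h5 : m.Prime → (m : ℤ) ≤ |b| → (3 : ℤ) ∣ b % (m : ℤ) → (m : ℤ) ∣ c)
    (hm3 : ¬ 3 ∣ m) (hm : 2 * T < m) (hm' : m < 3 * T) :
    ∃ i j : ℕ, i < j ∧ j ≤ T ∧ (m : ℤ) ∣ c * ((j : ℤ) - i) * (3 * ((i : ℤ) + j) + b) := by
  by_cases h2m : 2 ∣ m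
  · obtain ⟨w, rfl⟩ := h2m
    by_cases hc : Even c
    · obtain ⟨i, j, hij, hj, hd⟩ := aux_core b T w (by omega) (by omega) (by omega)
      refine ⟨i, j, hij, hj, ?_⟩
      push_cast
      exact mul_dvd_mul (Dvd.dvd.mul_right hc.two_dvd _) hd
    · have hbo : Odd b := by
        rw [← Int.not_even_iff_odd]; exact fun h => hc (h3 h)
      by_cases hw : 2 ∣ w
      · -- m = 2^e * o
        obtain ⟨e, o, ho, heo⟩ := Nat.exists_eq_pow_mul_and_not_dvd (n := w) (by omega) 2 (by norm_num)
        by_cases ho1 : o = 1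
        · subst ho1
          have hmx : 2 * w = 2 ^ (e + 1) := by rw [heo, pow_succ]; ring
          obtain ⟨i, j, hij, hj, hd⟩ := aux_q b T (2 * w) hm3 hm' (by omega)
            (Or.inr (by rintro rfl; revert hbo; decide)) hb3 h1 (by
              intro hle hdv
              exact hc (h4 ⟨hbo, e + 1, by omega, hmx, hle, hdv⟩))
          exact ⟨i, j, hij, hj, Dvd.dvd.mul_left hd _⟩
        · have he : e ≠ 0 := by
            rintro rfl
            simp at heo; omega
          set y := 2 ^ e with hy
          have hy2 : 2 ∣ y := dvd_pow_self 2 he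
          have hypos : 0 < y := by positivity
          have ho3 : ¬ 3 ∣ o := fun h => hm3 (by rw [heo]; exact Dvd.dvd.mul_left (Dvd.dvd.mul_left h _) _)
          have hy3 : ¬ 3 ∣ y := fun h => hm3 (by rw [heo]; exact Dvd.dvd.mul_left (Dvd.dvd.mul_right h _) _)
          have ho5 : 5 ≤ o := by omega
          obtain ⟨z, hz⟩ : (2 : ℤ) ∣ 3 * o + b := by
            obtain ⟨t, rfl⟩ := hbo; omega
          obtain ⟨i, hi, hd⟩ := aux_inv y hypos 3 z (aux_cop3 y hy3)
          refine ⟨i, i + o, by omega, ?_, ?_⟩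
          · have : 2 ≤ y := by omega
            nlinarith
          · have e1 : c * (((i + o : ℕ) : ℤ) - i) * (3 * ((i : ℤ) + ((i + o : ℕ) : ℤ)) + b)
                = (c * o) * (2 * (3 * i + z)) := by
              push_cast
              linear_combination (c * o) * hz
            rw [e1, heo]
            push_cast
            obtain ⟨t, ht⟩ := hd
            rw [ht]
            exact ⟨c * t, by rw [hy]; push_cast; ring⟩
      · obtain ⟨i, j, hij, hj, hd⟩ := aux_core b T w (by omega) (by omega) (by omega)
        refine ⟨i, j, hij, hj, ?_⟩
        have hcop : IsCoprime (2 : ℤ) (w : ℤ) := by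
          have : Nat.Coprime 2 w := (Nat.Prime.coprime_iff_not_dvd Nat.prime_two).2 hw
          exact_mod_cast Nat.isCoprime_iff_coprime.2 this
        push_cast
        apply hcop.mul_dvd
        · rw [mul_assoc]
          apply Dvd.dvd.mul_left
          obtain ⟨t, rfl⟩ := hbo
          by_cases hp : (2 : ℤ) ∣ (j : ℤ) - i
          · exact Dvd.dvd.mul_right hp _
          · apply Dvd.dvd.mul_left
            omega
        · exact Dvd.dvd.mul_left hd _
  · by_cases hp : m.Prime
    · by_cases hmc : (m : ℤ) ∣ c
      · exact ⟨0, 1, by omega, by omega, Dvd.dvd.mul_right (Dvd.dvd.mul_right hmc _) _⟩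
      · obtain ⟨i, j, hij, hj, hd⟩ := aux_q b T m hm3 hm' (by omega)
            (Or.inl (by omega)) hb3 h1 (fun hle hdv => hmc (h5 hp hle hdv))
        exact ⟨i, j, hij, hj, Dvd.dvd.mul_left hd _⟩
    · obtain ⟨u, v, hu, hv, huv⟩ := (Nat.not_prime_iff_exists_mul_eq (by omega)).1 hp
      subst huv
      have hu3 : ¬ 3 ∣ u := fun h => hm3 (Dvd.dvd.mul_right h _)
      have hv3 : ¬ 3 ∣ v := fun h => hm3 (Dvd.dvd.mul_left h _)
      have hu2 : ¬ 2 ∣ u := fun h => h2m (Dvd.dvd.mul_right h _)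
      have hv2 : ¬ 2 ∣ v := fun h => h2m (Dvd.dvd.mul_left h _)
      have hu1 : u ≠ 1 := by rintro rfl; omega
      have hv1 : v ≠ 1 := by rintro rfl; omega
      have hu5 : 5 ≤ u := by omega
      have hv5 : 5 ≤ v := by omega
      obtain ⟨i, hi, hd⟩ := aux_inv v (by omega) 6 (3 * u + b) (aux_cop6 v hv3 hv2)
      refine ⟨i, i + u, by omega, ?_, ?_⟩
      · nlinarith
      · obtain ⟨t, ht⟩ := hd
        refine ⟨c * t, ?_⟩
        push_cast
        linear_combination (c * u) * ht

theorem aux_caseB (b c : ℤ) (h3 : Even b → Even c) (T y n : ℕ) (hTo : ¬ 2 ∣ T) (hyodd : ¬ 2 ∣ y)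
    (hn3 : ¬ 3 ∣ n) (hn1 : n ≠ 1) (hy : 3 ≤ y) (hyT : y ≤ T) (hyT' : y < T → 3 * y ≤ T)
    (hm' : y * n < 3 * T) :
    ∃ i j : ℕ, i < j ∧ j ≤ T ∧
      ((y * n : ℕ) : ℤ) ∣ c * ((j : ℤ) - i) * (3 * ((i : ℤ) + j) + b) := by
  have hn0 : n ≠ 0 := by rintro rfl; omega
  by_cases hn2 : 2 ∣ n
  · obtain ⟨w, rfl⟩ := hn2
    have hw3 : ¬ 3 ∣ w := by omega
    have hbd : ∀ i, i < w → i + y ≤ T := by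
      intro i hi
      by_cases hw1 : w = 1
      · omega
      · have : 2 ≤ w := by omega
        nlinarith
    by_cases hb : Even b
    · obtain ⟨d, hc⟩ := (h3 hb).two_dvd
      by_cases hw : 2 ∣ w
      · obtain ⟨x, rfl⟩ := hw
        obtain ⟨i, hi, t, ht⟩ := aux_inv x (by omega) 3 (3 * y + b / 2) (aux_cop3 x (by omega))
        have hb2 : b = 2 * (b / 2) := by have := hb.two_dvd; omega
        refine ⟨i, i + 2 * y, by omega, ?_, 2 * d * t, ?_⟩
        · have hlt : y < T := by
            by_contra hcon
            have : y = T := by omega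
            subst this
            nlinarith
          have := hyT' hlt
          by_cases hx1 : x = 1
          · omega
          · have : 2 ≤ x := by omega
            nlinarith
        · rw [hc]
          push_cast
          linear_combination (8 * d * y) * ht + (4 * d * y) * hb2
      · obtain ⟨i, hi, t, ht⟩ := aux_inv w (by omega) 6 (3 * y + b) (aux_cop6 w hw3 hw)
        refine ⟨i, i + y, by omega, hbd i hi, d * t, ?_⟩
        rw [hc]
        push_cast
        linear_combination (2 * d * y) * ht
    · have hbo : Odd b := Int.not_even_iff_odd.1 hb
      · obtain ⟨z, hz⟩ : (2 : ℤ) ∣ 3 * y + b := by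
          obtain ⟨t, rfl⟩ := hbo; omega
        obtain ⟨i, hi, t, ht⟩ := aux_inv w (by omega) 3 z (aux_cop3 w hw3)
        refine ⟨i, i + y, by omega, hbd i hi, c * t, ?_⟩
        push_cast
        linear_combination (2 * c * y) * ht + (c * y) * hz
  · obtain ⟨i, hi, t, ht⟩ := aux_inv n (by omega) 6 (3 * y + b) (aux_cop6 n hn3 hn2)
    refine ⟨i, i + y, by omega, ?_, c * t, ?_⟩
    · have : 5 ≤ n := by omega
      by_cases hy3 : y = 3
      · subst hy3; omega
      · have : 5 ≤ y := by omega
        nlinarith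
    · push_cast
      linear_combination (c * y) * ht

/-- For `qt(n) = 3c n² + bc n` with non-zero integers `b, c`
satisfying conditions (1)–(5) (here `b % m` is the residue of `b` in
`{0, …, m−1}`, which is `Int.emod` for positive `m`), the discriminator equals
`3 ^ ⌈log₃ n⌉` (i.e. `3 ^ Nat.clog 3 n`) for all `n ≥ 1`. -/
theorem stmt_19 (b c : ℤ) (hb0 : b ≠ 0) (hc0 : c ≠ 0)
    (h1 : -2 ≤ b)
    (h2 : ¬ ((3 : ℤ) ∣ b * c))
    (h3 : Even b → Even c)
    (h4 : (Odd b ∧ ∃ x k : ℕ, 0 < x ∧ 0 < k ∧ 2 * 3 ^ k < 2 ^ x ∧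
        2 ^ x < 3 ^ (k + 1) ∧ (2 : ℤ) ^ x ≤ |b| ∧ (3 : ℤ) ∣ b % (2 : ℤ) ^ x) → Even c)
    (h5 : ∀ p : ℕ, p.Prime → (∃ k : ℕ, 0 < k ∧ 2 * 3 ^ k < p ∧ p < 3 ^ (k + 1)) →
        (p : ℤ) ≤ |b| → (3 : ℤ) ∣ b % (p : ℤ) → (p : ℤ) ∣ c)
    (qt : ℕ → ℤ) (hqt : ∀ n : ℕ, qt n = 3 * c * (n : ℤ) ^ 2 + b * c * (n : ℤ)) :
    ∀ n : ℕ, 1 ≤ n →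
      IsLeast {m : ℕ | 0 < m ∧ ∀ i j : ℕ, i < j → j < n → ¬ ((m : ℤ) ∣ qt j - qt i)}
        (3 ^ Nat.clog 3 n) := by
  intro n hn
  have hb3 : ¬ (3 : ℤ) ∣ b := fun h => h2 (Dvd.dvd.mul_right h _)
  have hc3 : ¬ (3 : ℤ) ∣ c := fun h => h2 (Dvd.dvd.mul_left h _)
  have hdiff : ∀ i j : ℕ, qt j - qt i = c * ((j : ℤ) - i) * (3 * ((i : ℤ) + j) + b) := by
    intro i j; rw [hqt, hqt]; ring
  have hp3 : Prime (3 : ℤ) := Int.prime_three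
  constructor
  · refine ⟨by positivity, ?_⟩
    intro i j hij hj hd
    rw [hdiff] at hd
    push_cast at hd
    have hd1 := (IsCoprime.pow_left ((Prime.coprime_iff_not_dvd hp3).2
      (by omega : ¬ (3 : ℤ) ∣ 3 * ((i : ℤ) + j) + b))).dvd_of_dvd_mul_right hd
    have hd2 := (IsCoprime.pow_left ((Prime.coprime_iff_not_dvd hp3).2 hc3)).dvd_of_dvd_mul_left hd1
    have hle := Int.le_of_dvd (by omega) hd2
    have hn' := Nat.le_pow_clog (b := 3) (by norm_num) n
    have : ((3 ^ Nat.clog 3 n : ℕ) : ℤ) = 3 ^ Nat.clog 3 n := by push_cast; rfl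
    omega
  · rintro m ⟨hm0, hm⟩
    by_contra! hlt
    rcases Nat.eq_zero_or_pos (Nat.clog 3 n) with h0 | hpos
    · rw [h0] at hlt; simp at hlt; omega
    obtain ⟨k, hk⟩ : ∃ k, Nat.clog 3 n = k + 1 := ⟨Nat.clog 3 n - 1, by omega⟩
    have hkn : 3 ^ k < n := by
      by_contra! hcon
      have := Nat.clog_le_of_le_pow hcon
      omega
    rw [hk] at hlt
    suffices h : ∃ i j : ℕ, i < j ∧ j ≤ 3 ^ k ∧
        (m : ℤ) ∣ c * ((j : ℤ) - i) * (3 * ((i : ℤ) + j) + b) by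
      obtain ⟨i, j, hij, hj, hd⟩ := h
      exact hm i j hij (by omega) (by rw [hdiff]; exact hd)
    have hlt' : m < 3 * 3 ^ k := by rw [pow_succ] at hlt; omega
    by_cases hmle : m ≤ 3 ^ k
    · refine ⟨0, m, hm0, hmle, ?_⟩
      simp only [Nat.cast_zero, sub_zero]
      exact Dvd.dvd.mul_right (Dvd.intro_left _ rfl) _
    rcases Nat.eq_zero_or_pos k with rfl | hkpos
    · have hm2 : m = 2 := by simp at hlt' hmle; omega
      subst hm2
      refine ⟨0, 1, by omega, by simp, ?_⟩
      rcases Int.even_or_odd b with hb | hb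
      · exact Dvd.dvd.mul_right (Dvd.dvd.mul_right (by exact_mod_cast (h3 hb).two_dvd) _) _
      · apply Dvd.dvd.mul_left
        obtain ⟨t, rfl⟩ := hb
        push_cast
        omega
    have hTo : ¬ 2 ∣ 3 ^ k := by
      rw [Nat.two_dvd_ne_zero]; exact Nat.odd_iff.1 (Odd.pow (by decide))
    have hT3 : 3 ≤ 3 ^ k := by
      calc 3 = 3 ^ 1 := rfl
        _ ≤ 3 ^ k := Nat.pow_le_pow_right (by norm_num) hkpos
    by_cases hm3 : 3 ∣ m
    · obtain ⟨a, n', hn3, hmn⟩ := Nat.exists_eq_pow_mul_and_not_dvd (n := m) (by omega) 3 (by norm_num)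
      have ha : a ≠ 0 := by rintro rfl; simp at hmn; omega
      have hn0 : n' ≠ 0 := by rintro rfl; omega
      have ham : 3 ^ a ≤ m := by rw [hmn]; exact Nat.le_mul_of_pos_right _ (by omega)
      have hak : a < k + 1 := (Nat.pow_lt_pow_iff_right (by norm_num : 1 < 3)).1 (lt_of_le_of_lt ham hlt)
      have hak' : 3 ^ a ≤ 3 ^ k := Nat.pow_le_pow_right (by norm_num) (by omega)
      rw [hmn]
      apply aux_caseB b c h3 (3 ^ k) (3 ^ a) n' hTo (by
        rw [Nat.two_dvd_ne_zero]; exact Nat.odd_iff.1 (Odd.pow (by decide))) hn3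
      · rintro rfl; omega
      · calc 3 = 3 ^ 1 := rfl
          _ ≤ 3 ^ a := Nat.pow_le_pow_right (by norm_num) (by omega)
      · exact hak'
      · intro h
        have : a < k := (Nat.pow_lt_pow_iff_right (by norm_num : 1 < 3)).1 h
        calc 3 * 3 ^ a = 3 ^ (a + 1) := by ring
          _ ≤ 3 ^ k := Nat.pow_le_pow_right (by norm_num) (by omega)
      · omega
    · by_cases hm2 : m < 2 * 3 ^ k
      · obtain ⟨i, j, hij, hj, hd⟩ := aux_core b (3 ^ k) m hm3 hm0 hm2
        exact ⟨i, j, hij, hj, Dvd.dvd.mul_left hd _⟩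
      · have hne : m ≠ 2 * 3 ^ k := by
          rintro rfl
          exact hm3 (Dvd.dvd.mul_left (dvd_pow_self 3 (by omega)) _)
        apply aux_caseA b c h1 hb3 h3 (3 ^ k) m hT3 hTo _ _ hm3 (by omega) hlt'
        · rintro ⟨hbo, x, hx, rfl, hle, hdv⟩
          push_cast at hle hdv
          exact h4 ⟨hbo, x, k, hx, hkpos, by omega, hlt, hle, hdv⟩
        · intro hp hle hdv
          exact h5 m hp ⟨k, hkpos, by omega, hlt⟩ hle hdv
end
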